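/- Let V, W be real Banach spaces, R̄ = ∏_{i=1}^{n}[a_i, b_i] ⊂ ℝ^n a closed rectangular box, Ω ⊆ V open, and l ∈ ℕ. If f : Ω → W is C^l, then the set U = {u ∈ C(R̄, V) : u(R̄) ⊆ Ω} is open in the Banach space C(R̄, V) of continuous maps with the sup norm, and the composition map F : U → C(R̄, W), F(u) = f ∘ u, is C^l. Moreover, when l ≥ 1 its Fréchet derivative is given by (DF(u)ζ)(t) = Df(u(t))(ζ(t)) for u ∈ U, ζ ∈ C(R̄, V), t ∈ R̄. -/

import Mathlib

open scoped Topology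

namespace ContinuousMap

section Topological

variable {X Y Z : Type*} [TopologicalSpace X] [TopologicalSpace Z]

theorem isOpen_setOf_forall_mem [TopologicalSpace Y] [CompactSpace X] {Ω : Set Y}
    (hΩ : IsOpen Ω) :
    IsOpen {u : C(X, Y) | ∀ t, u t ∈ Ω} := by
  simpa [Set.MapsTo] using isOpen_setOfPred_mapsTo (X := X) isCompact_univ hΩ

theorem continuousOn_postcomp [PseudoMetricSpace Y] [CompactSpace X] {Ω : Set Y}
    {f : Y → Z} (hf : ContinuousOn f Ω)
    {F : C(X, Y) → C(X, Z)} (hF : ∀ u : C(X, Y), (∀ t, u t ∈ Ω) → ∀ t, F u t = f (u t)) :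
    ContinuousOn F {u : C(X, Y) | ∀ t, u t ∈ Ω} := by
  rw [continuousOn_iff_continuous_domRestrict]
  refine continuous_of_continuous_uncurry _ ?_
  have h : Continuous fun p : {u : C(X, Y) | ∀ t, u t ∈ Ω} × X => f (p.1.1 p.2) :=
    hf.comp_continuous (by fun_prop) fun p => p.1.2 p.2
  exact h.congr fun p => (hF p.1.1 p.1.2 p.2).symm

theorem exists_postcomp [TopologicalSpace Y] [Zero Z] {Ω : Set Y} {f : Y → Z}
    (hf : ContinuousOn f Ω) :
    ∃ F : C(X, Y) → C(X, Z), ∀ u : C(X, Y), (∀ t, u t ∈ Ω) → ∀ t, F u t = f (u t) := by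
  classical
  refine ⟨fun u => if h : ∀ t, u t ∈ Ω then
    ⟨fun t => f (u t), hf.comp_continuous u.continuous h⟩ else 0, fun u hu t => ?_⟩
  simp [hu]

end Topological

variable {X V W : Type*} [TopologicalSpace X] [CompactSpace X]
  [NormedAddCommGroup V] [NormedSpace ℝ V] [NormedAddCommGroup W] [NormedSpace ℝ W]

/-- Pointwise application of a continuous family of continuous linear maps, as a bounded bilinear
map. -/
noncomputable def pointwiseApplyL (X V W : Type*) [TopologicalSpace X] [CompactSpace X]
    [NormedAddCommGroup V] [NormedSpace ℝ V] [NormedAddCommGroup W] [NormedSpace ℝ W] :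
    C(X, V →L[ℝ] W) →L[ℝ] C(X, V) →L[ℝ] C(X, W) :=
  LinearMap.mkContinuous₂
    (LinearMap.mk₂ ℝ
      (fun (A : C(X, V →L[ℝ] W)) (ζ : C(X, V)) =>
        (⟨fun t => A t (ζ t), A.continuous.clm_apply ζ.continuous⟩ : C(X, W)))
      (fun _ _ _ => by ext; simp) (fun _ _ _ => by ext; simp)
      (fun _ _ _ => by ext; simp) (fun _ _ _ => by ext; simp))
    1 fun A ζ => by
      rw [one_mul]
      refine (norm_le _ (by positivity)).2 fun t => ?_
      exact (A t).le_of_opNorm_le_of_le (A.norm_coe_le_norm t) (ζ.norm_coe_le_norm t)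

@[simp]
theorem pointwiseApplyL_apply (A : C(X, V →L[ℝ] W)) (ζ : C(X, V)) (t : X) :
    pointwiseApplyL X V W A ζ t = A t (ζ t) := rfl

theorem hasFDerivAt_postcomp {Ω : Set V} (hΩ : IsOpen Ω) {f : V → W}
    (hf : DifferentiableOn ℝ f Ω) (hf' : ContinuousOn (fderiv ℝ f) Ω)
    {F : C(X, V) → C(X, W)} (hF : ∀ u : C(X, V), (∀ t, u t ∈ Ω) → ∀ t, F u t = f (u t))
    {G : C(X, V) → C(X, V →L[ℝ] W)}
    (hG : ∀ u : C(X, V), (∀ t, u t ∈ Ω) → ∀ t, G u t = fderiv ℝ f (u t))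
    {u : C(X, V)} (hu : ∀ t, u t ∈ Ω) :
    HasFDerivAt F (pointwiseApplyL X V W (G u)) u := by
  have hU := (isOpen_setOf_forall_mem (X := X) hΩ).mem_nhds hu
  have hGu := (continuousOn_postcomp hf' hG).continuousAt hU
  refine .of_isLittleO (Asymptotics.isLittleO_iff.2 fun ε hε => ?_)
  obtain ⟨δ, hδ, hball⟩ := Metric.mem_nhds_iff.1
    (Filter.inter_mem hU (hGu.preimage_mem_nhds (Metric.closedBall_mem_nhds (G u) hε)))
  filter_upwards [Metric.ball_mem_nhds u hδ] with v hv
  refine (norm_le _ (by positivity)).2 fun t => ?_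
  have key : ∀ x ∈ segment ℝ (u t) (v t), x ∈ Ω ∧ ‖fderiv ℝ f x - fderiv ℝ f (u t)‖ ≤ ε := by
    rintro x ⟨p, q, hp, hq, hpq, rfl⟩
    have hw := hball ((convex_ball u δ) (Metric.mem_ball_self hδ) hv hp hq hpq)
    refine ⟨hw.1 t, ?_⟩
    have h := (dist_apply_le_dist t).trans hw.2
    rwa [hG _ hw.1, hG u hu, dist_eq_norm] at h
  have hmv := (convex_segment (𝕜 := ℝ) (u t) (v t)).norm_image_sub_le_of_norm_hasFDerivWithin_le'
    (fun x hx => ((hf x (key x hx).1).differentiableAt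
      (hΩ.mem_nhds (key x hx).1)).hasFDerivAt.hasFDerivWithinAt)
    (fun x hx => (key x hx).2) (left_mem_segment ℝ _ _) (right_mem_segment ℝ _ _)
  have hvU : ∀ t, v t ∈ Ω := (hball hv).1
  calc ‖(F v - F u - pointwiseApplyL X V W (G u) (v - u)) t‖
      = ‖f (v t) - f (u t) - fderiv ℝ f (u t) (v t - u t)‖ := by
        simp [hF v hvU, hF u hu, hG u hu]
    _ ≤ ε * ‖v t - u t‖ := hmv
    _ ≤ ε * ‖v - u‖ := by gcongr; exact norm_coe_le_norm (v - u) t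

theorem contDiffOn_succ_postcomp {Ω : Set V} (hΩ : IsOpen Ω) {l : ℕ} {f : V → W}
    (hf : DifferentiableOn ℝ f Ω) (hf' : ContinuousOn (fderiv ℝ f) Ω)
    (ih : ∀ G : C(X, V) → C(X, V →L[ℝ] W),
      (∀ u : C(X, V), (∀ t, u t ∈ Ω) → ∀ t, G u t = fderiv ℝ f (u t)) →
        ContDiffOn ℝ l G {u : C(X, V) | ∀ t, u t ∈ Ω})
    {F : C(X, V) → C(X, W)} (hF : ∀ u : C(X, V), (∀ t, u t ∈ Ω) → ∀ t, F u t = f (u t)) :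
    ContDiffOn ℝ (l + 1) F {u : C(X, V) | ∀ t, u t ∈ Ω} := by
  obtain ⟨G, hG⟩ := exists_postcomp (X := X) hf'
  rw [contDiffOn_succ_iff_fderiv_of_isOpen (isOpen_setOf_forall_mem hΩ)]
  have hd := fun (u : C(X, V)) (hu : ∀ t, u t ∈ Ω) => hasFDerivAt_postcomp hΩ hf hf' hF hG hu
  refine ⟨fun u hu => (hd u hu).differentiableAt.differentiableWithinAt, by simp, ?_⟩
  have h := (pointwiseApplyL X V W).contDiff.comp_contDiffOn (ih G hG)
  exact h.congr fun u hu => (hd u hu).fderiv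

universe u v

/-- The codomain lives in a universe containing that of `V`, so that the induction can pass from
`f` to `fderiv ℝ f`; `contDiffOn_postcomp` removes this restriction. -/
theorem contDiffOn_postcomp_of_max_universe {V : Type u} [NormedAddCommGroup V] [NormedSpace ℝ V]
    {Ω : Set V} (hΩ : IsOpen Ω) (l : ℕ) :
    ∀ {W : Type (max u v)} [NormedAddCommGroup W] [NormedSpace ℝ W] {f : V → W},
      ContDiffOn ℝ l f Ω → ∀ {F : C(X, V) → C(X, W)},
      (∀ u : C(X, V), (∀ t, u t ∈ Ω) → ∀ t, F u t = f (u t)) →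
        ContDiffOn ℝ l F {u : C(X, V) | ∀ t, u t ∈ Ω} := by
  induction l with
  | zero =>
    intro W _ _ f hf F hF
    exact contDiffOn_zero.2 (continuousOn_postcomp hf.continuousOn hF)
  | succ l ih =>
    intro W _ _ f hf F hF
    rw [Nat.cast_succ] at hf ⊢
    have h := (contDiffOn_succ_iff_fderiv_of_isOpen hΩ).1 hf
    exact contDiffOn_succ_postcomp hΩ h.1 h.2.2.continuousOn (fun G hG => ih h.2.2 hG) hF

/-- Postcomposition with a `C^l` map is `C^l` on spaces of continuous maps on a compact space. -/
theorem contDiffOn_postcomp {Ω : Set V} (hΩ : IsOpen Ω) {l : ℕ} {f : V → W}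
    (hf : ContDiffOn ℝ l f Ω) {F : C(X, V) → C(X, W)}
    (hF : ∀ u : C(X, V), (∀ t, u t ∈ Ω) → ∀ t, F u t = f (u t)) :
    ContDiffOn ℝ l F {u : C(X, V) | ∀ t, u t ∈ Ω} := by
  cases l with
  | zero => exact contDiffOn_zero.2 (continuousOn_postcomp hf.continuousOn hF)
  | succ l =>
    rw [Nat.cast_succ] at hf ⊢
    have h := (contDiffOn_succ_iff_fderiv_of_isOpen hΩ).1 hf
    exact contDiffOn_succ_postcomp hΩ h.1 h.2.2.continuousOn
      (fun G hG => contDiffOn_postcomp_of_max_universe hΩ l h.2.2 hG) hF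

end ContinuousMap



/-- Let `V, W` be real Banach spaces, `R̄ = ∏ [a i, b i] ⊆ ℝⁿ` a closed box,
`Ω ⊆ V` open and `f : Ω → W` of class `C^l`.  Then `U = {u ∈ C(R̄, V) : u(R̄) ⊆ Ω}` is open in
the Banach space `C(R̄, V)` and the composition map `F(u) = f ∘ u` is `C^l` on `U`; moreover for
`l ≥ 1` its Fréchet derivative is `(DF(u)ζ)(t) = Df(u(t))(ζ(t))`. -/
theorem statement2 {V W : Type*} [NormedAddCommGroup V] [NormedSpace ℝ V] [CompleteSpace V]
    [NormedAddCommGroup W] [NormedSpace ℝ W] [CompleteSpace W]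
    (n : ℕ) (a b : Fin n → ℝ) (hab : ∀ i, a i ≤ b i)
    (Ω : Set V) (hΩ : IsOpen Ω) (l : ℕ) (f : V → W) (hf : ContDiffOn ℝ l f Ω)
    (F : C(Set.Icc a b, V) → C(Set.Icc a b, W))
    (hF : ∀ u : C(Set.Icc a b, V), (∀ t, u t ∈ Ω) → ∀ t, F u t = f (u t)) :
    IsOpen {u : C(Set.Icc a b, V) | ∀ t, u t ∈ Ω} ∧
    ContDiffOn ℝ l F {u : C(Set.Icc a b, V) | ∀ t, u t ∈ Ω} ∧
    (1 ≤ l → ∀ u : C(Set.Icc a b, V), (∀ t, u t ∈ Ω) →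
      ∀ ζ : C(Set.Icc a b, V), ∀ t : Set.Icc a b,
        (fderiv ℝ F u ζ) t = fderiv ℝ f (u t) (ζ t)) := by
  refine ⟨ContinuousMap.isOpen_setOf_forall_mem hΩ, ContinuousMap.contDiffOn_postcomp hΩ hf hF,
    fun hl u hu ζ t => ?_⟩
  have hf1 : ContDiffOn ℝ 1 f Ω := hf.of_le (by exact_mod_cast hl)
  have hf' := hf1.continuousOn_fderiv_of_isOpen hΩ le_rfl
  obtain ⟨G, hG⟩ := ContinuousMap.exists_postcomp (X := Set.Icc a b) hf'
  rw [(ContinuousMap.hasFDerivAt_postcomp hΩ (hf1.differentiableOn one_ne_zero) hf' hF hG hu).fderiv,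
    ContinuousMap.pointwiseApplyL_apply, hG u hu]
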